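/- arXiv:0908.2556 — 2 statements merged into one kernel-verified Lean document; each statement's English description precedes it below -/
import Mathlib

section
/- Contraction of backward kernels under a density-ratio condition: in the time-homogeneous case (E_n, G_n, M_n, H_n, λ_n) = (E, G, M, H, λ), suppose α ∈ (0,1] satisfies H(z,x) ≥ α H(z,x') for all z, x, x' ∈ E. Then for every probability measure η on E and all x, x' ∈ E, M_η(x, A) ≤ α^{-2} M_η(x', A) for every measurable A; consequently β(M_η) ≤ 1 − α², and for any probability measures μ_q, …, μ_{p-1} on E (q < p), β( M_{μ_{p-1}} M_{μ_{p-2}} ⋯ M_{μ_q} ) ≤ (1 − α²)^{p−q}. -/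
open MeasureTheory ProbabilityTheory ENNReal

noncomputable section

/-- The oscillation `osc(f) = sup_{x,y} |f x - f y|` of a (bounded) function. -/
def osc {α : Type*} (f : α → ℝ) : ℝ := sSup {d | ∃ x y, d = |f x - f y|}

/-- The Dobrushin contraction coefficient of a measure-valued map (kernel)
`κ : E → 𝓟(F)`: `β(κ) = sup { osc(κ(φ)) : φ bounded measurable, osc(φ) ≤ 1 }`. -/
def betaFn {α β : Type*} [MeasurableSpace β] (κ : α → Measure β) : ℝ :=
  sSup {r | ∃ φ : β → ℝ, Measurable φ ∧ (∀ x y, |φ x - φ y| ≤ 1)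
    ∧ r = osc fun x => ∫ y, φ y ∂ (κ x)}

/-- The Dobrushin contraction coefficient of an operator mapping functions on `α` to
functions on `β`. -/
def betaOp {α β : Type*} [MeasurableSpace α] (T : (α → ℝ) → β → ℝ) : ℝ :=
  sSup {r | ∃ φ : α → ℝ, Measurable φ ∧ (∀ x y, |φ x - φ y| ≤ 1) ∧ r = osc (T φ)}

variable {E : Type*} [MeasurableSpace E]

/-- The (time-homogeneous) backward kernel
`M_η(y,dx) = G(x) H(x,y) η(dx) / η(G H(·,y))`. -/
def MbackH (G : E → ℝ) (H : E → E → ℝ) (η : Measure E) (y : E) : Measure E :=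
  (∫⁻ x, ENNReal.ofReal (G x * H x y) ∂η)⁻¹ •
    η.withDensity fun x => ENNReal.ofReal (G x * H x y)

/-- The composition `M_{μ_{q+k-1}} M_{μ_{q+k-2}} ⋯ M_{μ_q}` of `k` backward kernels,
acting on bounded measurable functions. -/
def MchainH (G : E → ℝ) (H : E → E → ℝ) (μ : ℕ → Measure E) (q : ℕ) :
    ℕ → (E → ℝ) → E → ℝ
  | 0, f => f
  | k + 1, f => fun x => ∫ y, MchainH G H μ q k f y ∂ (MbackH G H (μ (q + k)) x)

theorem abs_integral_sub_integral_le_of_le_smul {F : Type*} [MeasurableSpace F]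
    {P Q : Measure F} [IsProbabilityMeasure P] [IsProbabilityMeasure Q]
    {ε : ℝ} (hε : 0 < ε) (hε1 : ε ≤ 1)
    (hPQ : P ≤ (ENNReal.ofReal ε)⁻¹ • Q) (hQP : Q ≤ (ENNReal.ofReal ε)⁻¹ • P)
    {φ : F → ℝ} (hφ : Measurable φ) {δ : ℝ} (hδ : ∀ x y, |φ x - φ y| ≤ δ) :
    |∫ x, φ x ∂P - ∫ x, φ x ∂Q| ≤ (1 - ε) * δ := by
  have hne : Nonempty F := nonempty_of_isProbabilityMeasure P
  have hbdd : BddBelow (Set.range φ) := by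
    obtain ⟨x₀⟩ := hne
    refine ⟨φ x₀ - δ, ?_⟩
    rintro _ ⟨y, rfl⟩
    linarith [(abs_le.mp (hδ x₀ y)).2]
  set c := ⨅ x, φ x
  have hc0 : ∀ x, 0 ≤ φ x - c := fun x => sub_nonneg.mpr (ciInf_le hbdd x)
  have hcδ : ∀ x, φ x - c ≤ δ := fun x => by
    have : φ x - δ ≤ c := le_ciInf fun y => by linarith [(abs_le.mp (hδ x y)).2]
    linarith
  have hint : ∀ ν : Measure F, IsFiniteMeasure ν → Integrable (fun x => φ x - c) ν :=
    fun ν _ => Integrable.of_bound (hφ.sub_const c).aestronglyMeasurable δ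
      (ae_of_all _ fun x => by rw [Real.norm_of_nonneg (hc0 x)]; exact hcδ x)
  have hshift : ∀ ν : Measure F, IsProbabilityMeasure ν →
      ∫ x, φ x ∂ν = ∫ x, (φ x - c) ∂ν + c := fun ν _ => by
    have h := integral_add (hint ν inferInstance) (integrable_const c)
    simpa using h
  have hle : ∀ ν : Measure F, IsProbabilityMeasure ν → ∫ x, (φ x - c) ∂ν ≤ δ := fun ν _ => by
    simpa using integral_mono (hint ν inferInstance) (integrable_const δ) hcδ
  have hcomp : ∀ ν ρ : Measure F, IsProbabilityMeasure ν → IsProbabilityMeasure ρ →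
      ν ≤ (ENNReal.ofReal ε)⁻¹ • ρ → ε * ∫ x, (φ x - c) ∂ν ≤ ∫ x, (φ x - c) ∂ρ := by
    intro ν ρ _ _ h
    have htop : (ENNReal.ofReal ε)⁻¹ ≠ ⊤ := by simpa using hε
    have h' := integral_mono_measure h (ae_of_all _ hc0)
      ((hint ρ inferInstance).smul_measure htop)
    rw [integral_smul_measure, ENNReal.toReal_inv, ENNReal.toReal_ofReal hε.le, smul_eq_mul,
      ← div_eq_inv_mul, le_div_iff₀ hε] at h'
    linarith
  have h1 := hcomp P Q inferInstance inferInstance hPQ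
  have h2 := hcomp Q P inferInstance inferInstance hQP
  have h3 := mul_le_mul_of_nonneg_left (hle P inferInstance) (sub_nonneg.mpr hε1)
  have h4 := mul_le_mul_of_nonneg_left (hle Q inferInstance) (sub_nonneg.mpr hε1)
  rw [hshift P inferInstance, hshift Q inferInstance, abs_le]
  constructor <;> linarith

theorem osc_le {F : Type*} {f : F → ℝ} {δ : ℝ} (hδ : 0 ≤ δ) (h : ∀ x y, |f x - f y| ≤ δ) :
    osc f ≤ δ := by
  refine Real.sSup_le ?_ hδ
  rintro _ ⟨x, y, rfl⟩
  exact h x y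

theorem isProbabilityMeasure_MbackH {G : E → ℝ} (hGm : Measurable G) (hG : ∀ x, 0 < G x)
    {H : E → E → ℝ} (hHm : Measurable (Function.uncurry H)) (hHpos : ∀ x y, 0 < H x y)
    (η : Measure E) [IsProbabilityMeasure η] (y : E)
    (hint : ∫⁻ x, ENNReal.ofReal (G x * H x y) ∂η < ⊤) :
    IsProbabilityMeasure (MbackH G H η y) := by
  have hm : Measurable fun x => ENNReal.ofReal (G x * H x y) :=
    (hGm.mul hHm.of_uncurry_right).ennreal_ofReal
  have hZ : ∫⁻ x, ENNReal.ofReal (G x * H x y) ∂η ≠ 0 := by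
    intro h0
    rw [lintegral_eq_zero_iff hm] at h0
    obtain ⟨x, hx⟩ := h0.exists
    exact (ENNReal.ofReal_pos.mpr (mul_pos (hG x) (hHpos x y))).ne' hx
  constructor
  rw [MbackH, Measure.smul_apply, withDensity_apply _ MeasurableSet.univ,
    Measure.restrict_univ, smul_eq_mul]
  exact ENNReal.inv_mul_cancel hZ hint.ne

theorem MbackH_le_smul {G : E → ℝ} (hG : ∀ x, 0 < G x) {H : E → E → ℝ}
    {α : ℝ} (hα : 0 < α) (hHα : ∀ z x x', α * H z x' ≤ H z x)
    (η : Measure E) (x x' : E) :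
    MbackH G H η x ≤ (ENNReal.ofReal (α ^ 2))⁻¹ • MbackH G H η x' := by
  have ha0 : ENNReal.ofReal α ≠ 0 := (ENNReal.ofReal_pos.mpr hα).ne'
  have hat : ENNReal.ofReal α ≠ ⊤ := ENNReal.ofReal_ne_top
  have hw : ∀ y y' z, ENNReal.ofReal α * ENNReal.ofReal (G z * H z y') ≤
      ENNReal.ofReal (G z * H z y) := fun y y' z => by
    rw [← ENNReal.ofReal_mul hα.le]
    refine ENNReal.ofReal_le_ofReal ?_
    nlinarith [mul_le_mul_of_nonneg_left (hHα z y y') (hG z).le]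
  have hZ : ENNReal.ofReal α * ∫⁻ z, ENNReal.ofReal (G z * H z x') ∂η ≤
      ∫⁻ z, ENNReal.ofReal (G z * H z x) ∂η := by
    rw [← lintegral_const_mul' _ _ hat]
    exact lintegral_mono (hw x x')
  have hdens : (η.withDensity fun z => ENNReal.ofReal (G z * H z x)) ≤
      (ENNReal.ofReal α)⁻¹ • η.withDensity fun z => ENNReal.ofReal (G z * H z x') := by
    rw [← withDensity_smul' _ _ (ENNReal.inv_ne_top.mpr ha0)]
    refine withDensity_mono (ae_of_all _ fun z => ?_)
    rw [Pi.smul_apply, smul_eq_mul]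
    exact (ENNReal.mul_le_iff_le_inv ha0 hat).mp (hw x' x z)
  have hZinv : (∫⁻ z, ENNReal.ofReal (G z * H z x) ∂η)⁻¹ ≤
      (ENNReal.ofReal α)⁻¹ * (∫⁻ z, ENNReal.ofReal (G z * H z x') ∂η)⁻¹ := by
    rw [← ENNReal.mul_inv (Or.inl ha0) (Or.inl hat)]
    exact ENNReal.inv_le_inv.mpr hZ
  have hsq : (ENNReal.ofReal (α ^ 2))⁻¹ = (ENNReal.ofReal α)⁻¹ * (ENNReal.ofReal α)⁻¹ := by
    rw [sq, ENNReal.ofReal_mul hα.le, ENNReal.mul_inv (Or.inl ha0) (Or.inl hat)]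
  refine Measure.le_intro fun A _ _ => ?_
  have hA := hdens A
  simp only [MbackH, Measure.smul_apply, smul_eq_mul] at hA ⊢
  refine (mul_le_mul' hZinv hA).trans_eq ?_
  rw [hsq]
  ring

theorem measurable_integral_MbackH {G : E → ℝ} (hGm : Measurable G)
    {H : E → E → ℝ} (hHm : Measurable (Function.uncurry H))
    (η : Measure E) [SFinite η] {f : E → ℝ} (hf : Measurable f) :
    Measurable fun x => ∫ y, f y ∂(MbackH G H η x) := by
  have hw : Measurable fun p : E × E => ENNReal.ofReal (G p.1 * H p.1 p.2) :=
    ((hGm.comp measurable_fst).mul hHm).ennreal_ofReal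
  have heq : (fun x => ∫ y, f y ∂(MbackH G H η x)) = fun x =>
      ((∫⁻ z, ENNReal.ofReal (G z * H z x) ∂η)⁻¹).toReal *
        ∫ z, (ENNReal.ofReal (G z * H z x)).toReal * f z ∂η := by
    funext x
    have hwx : Measurable fun z => ENNReal.ofReal (G z * H z x) :=
      hw.comp measurable_prodMk_right
    rw [MbackH, integral_smul_measure, smul_eq_mul, integral_withDensity_eq_integral_toReal_smul
      hwx (ae_of_all _ fun _ => ENNReal.ofReal_lt_top)]
    simp only [smul_eq_mul]
  rw [heq]
  refine (hw.lintegral_prod_left' (μ := η)).inv.ennreal_toReal.mul ?_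
  exact (StronglyMeasurable.integral_prod_left' (μ := η)
    (f := fun p : E × E => (ENNReal.ofReal (G p.1 * H p.1 p.2)).toReal * f p.1)
    (hw.ennreal_toReal.mul (hf.comp measurable_fst)).stronglyMeasurable).measurable

theorem measurable_MchainH {G : E → ℝ} (hGm : Measurable G)
    {H : E → E → ℝ} (hHm : Measurable (Function.uncurry H))
    (μ : ℕ → Measure E) [∀ n, SFinite (μ n)] (q k : ℕ) {f : E → ℝ} (hf : Measurable f) :
    Measurable (MchainH G H μ q k f) := by
  induction k with
  | zero => exact hf
  | succ k ih => exact measurable_integral_MbackH hGm hHm _ ih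

/-- contraction of backward kernels under a density-ratio condition.
In the time-homogeneous case, if `H(z,x) ≥ α H(z,x')` for all `z,x,x'` with `α ∈ (0,1]`,
then `M_η(x,A) ≤ α⁻² M_η(x',A)` for every probability measure `η`; consequently
`β(M_η) ≤ 1 − α²`, and for any probability measures `μ_q,…,μ_{p-1}` (`q < p`),
`β(M_{μ_{p-1}} ⋯ M_{μ_q}) ≤ (1 − α²)^{p−q}`. -/
theorem backward_kernel_contraction
    (M : Kernel E E) (hM : IsMarkovKernel M)
    (G : E → ℝ) (hGm : Measurable G) (hG : ∀ x, G x ∈ Set.Ioc (0:ℝ) 1)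
    (H : E → E → ℝ) (hHm : Measurable (Function.uncurry H)) (hHpos : ∀ x y, 0 < H x y)
    (lam : Measure E) (hlam : SigmaFinite lam)
    (hMH : ∀ x, (M x : Measure E) = lam.withDensity fun y => ENNReal.ofReal (H x y))
    (hHint : ∀ (η : Measure E), IsProbabilityMeasure η → ∀ y,
      ∫⁻ x, ENNReal.ofReal (G x * H x y) ∂η < ⊤)
    (α : ℝ) (hα : α ∈ Set.Ioc (0:ℝ) 1)
    (hHα : ∀ z x x', α * H z x' ≤ H z x) :
    (∀ (η : Measure E), IsProbabilityMeasure η → ∀ x x' (A : Set E),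
        MbackH G H η x A ≤ (ENNReal.ofReal (α^2))⁻¹ * MbackH G H η x' A)
    ∧ (∀ (η : Measure E), IsProbabilityMeasure η → betaFn (MbackH G H η) ≤ 1 - α^2)
    ∧ ∀ (μ : ℕ → Measure E), (∀ q, IsProbabilityMeasure (μ q)) →
        ∀ q p, q < p → betaOp (MchainH G H μ q (p - q)) ≤ (1 - α^2)^(p - q) := by
  have hα2 : 0 < α ^ 2 := pow_pos hα.1 2
  have hα1 : α ^ 2 ≤ 1 := pow_le_one₀ hα.1.le hα.2
  have hG0 : ∀ x, 0 < G x := fun x => (hG x).1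
  have hcontr : ∀ η : Measure E, IsProbabilityMeasure η → ∀ (φ : E → ℝ), Measurable φ →
      ∀ δ : ℝ, (∀ x y, |φ x - φ y| ≤ δ) → ∀ x x',
        |∫ y, φ y ∂(MbackH G H η x) - ∫ y, φ y ∂(MbackH G H η x')| ≤ (1 - α ^ 2) * δ := by
    intro η hη φ hφ δ hδ x x'
    have := isProbabilityMeasure_MbackH hGm hG0 hHm hHpos η x (hHint η hη x)
    have := isProbabilityMeasure_MbackH hGm hG0 hHm hHpos η x' (hHint η hη x')
    exact abs_integral_sub_integral_le_of_le_smul hα2 hα1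
      (MbackH_le_smul hG0 hα.1 hHα η x x') (MbackH_le_smul hG0 hα.1 hHα η x' x) hφ hδ
  have hnn : 0 ≤ 1 - α ^ 2 := sub_nonneg.mpr hα1
  refine ⟨fun η _ x x' A => MbackH_le_smul hG0 hα.1 hHα η x x' A, fun η hη => ?_,
    fun μ hμ q p _ => ?_⟩
  · refine Real.sSup_le ?_ hnn
    rintro _ ⟨φ, hφ, hosc, rfl⟩
    exact osc_le hnn fun x x' => (hcontr η hη φ hφ 1 hosc x x').trans_eq (mul_one _)
  · refine Real.sSup_le ?_ (pow_nonneg hnn _)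
    rintro _ ⟨φ, hφ, hosc, rfl⟩
    refine osc_le (pow_nonneg hnn _) ?_
    generalize p - q = k
    induction k with
    | zero => simpa [MchainH] using hosc
    | succ k ih =>
      intro x x'
      rw [pow_succ']
      exact hcontr _ (hμ _) _ (measurable_MchainH hGm hHm μ q k hφ) _ ih x x'

end
end

section
/- Moment-to-Gaussian-concentration transfer: let U be a nonnegative random variable and b > 0 a constant such that E(U^r)^{1/r} ≤ a_r b for every integer r ≥ 1, where the constants a_r are defined by a_{2r}^{2r} = (2r)! 2^{-r}/r! and a_{2r+1}^{2r+1} = (2r+1)! 2^{-r}/r! (r ≥ 0). Then for every t ≥ 0, E(e^{tU}) ≤ exp( bt + (bt)²/2 ), and consequently for every ε > 0, P( U ≥ b + ε ) ≤ exp( −ε² / (2b²) ). -/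
open MeasureTheory

/-- The power series with coefficients `a_n ^ n / n!` sums to `(1 + x) exp (x² / 2)`. -/
lemma hasSum_moment_series (a : ℕ → ℝ)
    (haeven : ∀ r : ℕ,
      a (2*r) ^ (2*r) = (Nat.factorial (2*r) : ℝ) / (2^r * (Nat.factorial r : ℝ)))
    (haodd : ∀ r : ℕ,
      a (2*r+1) ^ (2*r+1) = (Nat.factorial (2*r+1) : ℝ) / (2^r * (Nat.factorial r : ℝ)))
    (x : ℝ) :
    HasSum (fun n : ℕ => x ^ n / (Nat.factorial n : ℝ) * a n ^ n)
      ((1 + x) * Real.exp (x ^ 2 / 2)) := by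
  have hexp : HasSum (fun r : ℕ => (x ^ 2 / 2) ^ r / (Nat.factorial r : ℝ))
      (Real.exp (x ^ 2 / 2)) := by
    rw [Real.exp_eq_exp_ℝ]
    exact NormedSpace.expSeries_div_hasSum_exp (x ^ 2 / 2)
  rw [add_mul, one_mul]
  refine HasSum.even_add_odd ?_ ?_
  · convert hexp using 2 with r
    have h1 : (Nat.factorial (2 * r) : ℝ) ≠ 0 := by positivity
    rw [haeven, pow_mul, div_pow]
    field_simp
  · have hodd : HasSum (fun r : ℕ => x * ((x ^ 2 / 2) ^ r / (Nat.factorial r : ℝ)))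
        (x * Real.exp (x ^ 2 / 2)) := hexp.mul_left x
    convert hodd using 2 with r
    have h1 : (Nat.factorial (2 * r + 1) : ℝ) ≠ 0 := by positivity
    rw [haodd, pow_succ, pow_mul, div_pow]
    field_simp

/-- The exponential moment is the sum of the rescaled moments. -/
lemma lintegral_exp_eq_tsum_moments {Ω : Type*} [MeasurableSpace Ω] (P : Measure Ω)
    {U : Ω → ℝ} (hUm : Measurable U) (hU0 : ∀ ω, 0 ≤ U ω) {t : ℝ} (ht : 0 ≤ t) :
    ∫⁻ ω, ENNReal.ofReal (Real.exp (t * U ω)) ∂P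
      = ∑' n : ℕ, ENNReal.ofReal (t ^ n / (Nat.factorial n : ℝ))
          * ∫⁻ ω, ENNReal.ofReal (U ω ^ n) ∂P := by
  have hpt : ∀ ω, ENNReal.ofReal (Real.exp (t * U ω))
      = ∑' n : ℕ, ENNReal.ofReal (t ^ n / (Nat.factorial n : ℝ))
          * ENNReal.ofReal (U ω ^ n) := by
    intro ω
    have hsum := NormedSpace.expSeries_div_hasSum_exp (t * U ω)
    rw [← Real.exp_eq_exp_ℝ] at hsum
    have hnn : ∀ n : ℕ, 0 ≤ (t * U ω) ^ n / (Nat.factorial n : ℝ) := fun n => by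
      have := hU0 ω
      positivity
    rw [← hsum.tsum_eq, ENNReal.ofReal_tsum_of_nonneg hnn hsum.summable]
    refine tsum_congr fun n => ?_
    rw [← ENNReal.ofReal_mul (by positivity), mul_pow, mul_div_right_comm]
  simp_rw [hpt]
  rw [lintegral_tsum fun n => by fun_prop]
  exact tsum_congr fun n => lintegral_const_mul _ (by fun_prop)

/-- Chernoff bound from a shifted Gaussian bound on the exponential moments. -/
lemma measure_ge_le_of_lintegral_exp_le {Ω : Type*} [MeasurableSpace Ω] (P : Measure Ω)
    {U : Ω → ℝ} (hUm : Measurable U) {b : ℝ} (hb : 0 < b)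
    (hexp : ∀ t : ℝ, 0 ≤ t →
      ∫⁻ ω, ENNReal.ofReal (Real.exp (t * U ω)) ∂P
        ≤ ENNReal.ofReal (Real.exp (b*t + (b*t)^2/2)))
    {ε : ℝ} (hε : 0 < ε) :
    P {ω | b + ε ≤ U ω} ≤ ENNReal.ofReal (Real.exp (-(ε^2) / (2*b^2))) := by
  set t : ℝ := ε / b ^ 2 with ht_def
  have ht : 0 < t := by positivity
  have hmarkov := (mul_meas_ge_le_lintegral (μ := P)
    (f := fun ω => ENNReal.ofReal (Real.exp (t * U ω))) (by fun_prop)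
    (ENNReal.ofReal (Real.exp (t * (b + ε))))).trans (hexp t ht.le)
  have hset : {ω | ENNReal.ofReal (Real.exp (t * (b + ε)))
      ≤ ENNReal.ofReal (Real.exp (t * U ω))} = {ω | b + ε ≤ U ω} := by
    ext ω
    simp only [Set.mem_ofPred_eq]
    rw [ENNReal.ofReal_le_ofReal_iff (Real.exp_pos _).le, Real.exp_le_exp,
      mul_le_mul_iff_right₀ ht]
  have hfactor : b * t + (b * t) ^ 2 / 2 = t * (b + ε) + -(ε ^ 2) / (2 * b ^ 2) := by
    rw [ht_def]
    field_simp
    ring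
  rw [hset, hfactor, Real.exp_add, ENNReal.ofReal_mul (Real.exp_pos _).le] at hmarkov
  exact (ENNReal.mul_le_mul_iff_right
    (ENNReal.ofReal_pos.2 (Real.exp_pos _)).ne' ENNReal.ofReal_ne_top).1 hmarkov

/-- moment-to-Gaussian-concentration transfer. Let `U ≥ 0` be a random
variable and `b > 0` with `E(U^r)^{1/r} ≤ a_r b` for every `r ≥ 1`, where
`a_{2r}^{2r} = (2r)!/(2^r r!)` and `a_{2r+1}^{2r+1} = (2r+1)!/(2^r r!)`. Then for every
`t ≥ 0`, `E(e^{tU}) ≤ exp(bt + (bt)²/2)`, and consequently for every `ε > 0`,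
`P(U ≥ b + ε) ≤ exp(−ε²/(2b²))`. -/
theorem moment_gaussian_concentration
    {Ω : Type*} [MeasurableSpace Ω] (P : Measure Ω) (hP : IsProbabilityMeasure P)
    (U : Ω → ℝ) (hUm : Measurable U) (hU0 : ∀ ω, 0 ≤ U ω)
    (b : ℝ) (hb : 0 < b)
    (a : ℕ → ℝ) (ha0 : ∀ r, 0 ≤ a r)
    (haeven : ∀ r : ℕ,
      a (2*r) ^ (2*r) = (Nat.factorial (2*r) : ℝ) / (2^r * (Nat.factorial r : ℝ)))
    (haodd : ∀ r : ℕ,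
      a (2*r+1) ^ (2*r+1) = (Nat.factorial (2*r+1) : ℝ) / (2^r * (Nat.factorial r : ℝ)))
    (hmom : ∀ r : ℕ, 1 ≤ r →
      ∫⁻ ω, ENNReal.ofReal (U ω ^ r) ∂P ≤ ENNReal.ofReal (a r ^ r * b ^ r)) :
    (∀ t : ℝ, 0 ≤ t →
        ∫⁻ ω, ENNReal.ofReal (Real.exp (t * U ω)) ∂P
          ≤ ENNReal.ofReal (Real.exp (b*t + (b*t)^2/2)))
    ∧ ∀ ε : ℝ, 0 < ε →
        P {ω | b + ε ≤ U ω} ≤ ENNReal.ofReal (Real.exp (-(ε^2) / (2*b^2))) := by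
  have hexp : ∀ t : ℝ, 0 ≤ t →
      ∫⁻ ω, ENNReal.ofReal (Real.exp (t * U ω)) ∂P
        ≤ ENNReal.ofReal (Real.exp (b*t + (b*t)^2/2)) := by
    intro t ht
    have hsum := hasSum_moment_series a haeven haodd (b * t)
    have hnn : ∀ n : ℕ, 0 ≤ (b * t) ^ n / (Nat.factorial n : ℝ) * a n ^ n := fun n => by
      have := ha0 n
      positivity
    rw [lintegral_exp_eq_tsum_moments P hUm hU0 ht]
    calc ∑' n : ℕ, ENNReal.ofReal (t ^ n / (Nat.factorial n : ℝ))
          * ∫⁻ ω, ENNReal.ofReal (U ω ^ n) ∂P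
        ≤ ∑' n : ℕ, ENNReal.ofReal ((b * t) ^ n / (Nat.factorial n : ℝ) * a n ^ n) := by
          refine ENNReal.tsum_le_tsum fun n => ?_
          have hn : ∫⁻ ω, ENNReal.ofReal (U ω ^ n) ∂P
              ≤ ENNReal.ofReal (a n ^ n * b ^ n) := by
            rcases Nat.eq_zero_or_pos n with rfl | hn
            · simp
            · exact hmom n hn
          refine (mul_le_mul_right hn _).trans_eq ?_
          rw [← ENNReal.ofReal_mul (by positivity)]
          congr 1
          ring
      _ = ENNReal.ofReal ((1 + b * t) * Real.exp ((b * t) ^ 2 / 2)) := by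
          rw [← ENNReal.ofReal_tsum_of_nonneg hnn hsum.summable, hsum.tsum_eq]
      _ ≤ ENNReal.ofReal (Real.exp (b*t + (b*t)^2/2)) := by
          rw [Real.exp_add]
          gcongr
          linarith [Real.add_one_le_exp (b * t)]
  exact ⟨hexp, fun ε hε => measure_ge_le_of_lintegral_exp_le P hUm hb hexp hε⟩
end
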